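/- With σ = (σ^{ab}_{cd})_{a,b,c,d ∈ X} constructed from the finite quasigroup QG and the ternary operation μ as in the context, σ is rigid: for all a,b ∈ X there exist x_{ab}, y_{ab} ∈ A_σ such that Σ_{c∈X} ((L⁻¹)_{cb} + I_σ)x_{ac} = Σ_{c∈X} x_{cb}((L⁻¹)_{ac} + I_σ) = Σ_{c∈X} (L_{cb} + I_σ)y_{ac} = Σ_{c∈X} y_{cb}(L_{ac} + I_σ) = δ_{ab}1_{A_σ}. -/

import Mathlib

open scoped TensorProduct
open MulOpposite

noncomputable section

set_option linter.unusedSectionVars false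

variable (k L X G : Type*) [CommRing k] [Ring L] [Algebra k L] [Fintype X]
  [DecidableEq X] [Group G]

/-- The set `Gen` of generators: the underlying set of `L ⊗[k] Lᵐᵒᵖ` together with two
families of formal symbols `L_{ab}` and `(L⁻¹)_{ab}` indexed by `X × X`. -/
abbrev Gen : Type _ := (L ⊗[k] Lᵐᵒᵖ) ⊕ (X × X) ⊕ (X × X)

/-- The generator of `k⟨Gen⟩` corresponding to `ξ ∈ L ⊗[k] Lᵐᵒᵖ`. -/
def iT (ξ : L ⊗[k] Lᵐᵒᵖ) : FreeAlgebra k (Gen k L X) := FreeAlgebra.ι k (Sum.inl ξ)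

/-- The generator `L_{ab}` of `k⟨Gen⟩`. -/
def iL (a b : X) : FreeAlgebra k (Gen k L X) := FreeAlgebra.ι k (Sum.inr (Sum.inl (a, b)))

/-- The generator `(L⁻¹)_{ab}` of `k⟨Gen⟩`. -/
def iLi (a b : X) : FreeAlgebra k (Gen k L X) := FreeAlgebra.ι k (Sum.inr (Sum.inr (a, b)))

/-- `f ⊗ 1_L ∈ L ⊗[k] Lᵐᵒᵖ`. -/
def sE (f : L) : L ⊗[k] Lᵐᵒᵖ := f ⊗ₜ[k] (1 : Lᵐᵒᵖ)

/-- `1_L ⊗ f ∈ L ⊗[k] Lᵐᵒᵖ`. -/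
def tE (f : L) : L ⊗[k] Lᵐᵒᵖ := (1 : L) ⊗ₜ[k] (op f)

variable (deg : X → G) (T : G → L ≃ₐ[k] L) (σ : X → X → X → X → L)

/-- The set of generators (i)–(v) of the two-sided ideal `I_σ`. -/
def relSet : Set (FreeAlgebra k (Gen k L X)) :=
  {w | (∃ ξ ξ' : L ⊗[k] Lᵐᵒᵖ, w = iT k L X ξ + iT k L X ξ' - iT k L X (ξ + ξ')) ∨
    (∃ (c : k) (ξ : L ⊗[k] Lᵐᵒᵖ), w = c • iT k L X ξ - iT k L X (c • ξ)) ∨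
    (∃ ξ ξ' : L ⊗[k] Lᵐᵒᵖ, w = iT k L X ξ * iT k L X ξ' - iT k L X (ξ * ξ')) ∨
    (∃ a b : X, w = (∑ c : X, iL k L X a c * iLi k L X c b) - if a = b then 1 else 0) ∨
    (∃ a b : X, w = (∑ c : X, iLi k L X a c * iL k L X c b) - if a = b then 1 else 0) ∨
    (∃ (f : L) (a b : X),
      w = iT k L X (sE k L (T (deg a) f)) * iL k L X a b - iL k L X a b * iT k L X (sE k L f)) ∨
    (∃ (f : L) (a b : X),
      w = iT k L X (tE k L (T (deg b) f)) * iL k L X a b - iL k L X a b * iT k L X (tE k L f)) ∨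
    (∃ (f : L) (a b : X),
      w = iT k L X (sE k L f) * iLi k L X a b - iLi k L X a b * iT k L X (sE k L (T (deg b) f))) ∨
    (∃ (f : L) (a b : X),
      w = iT k L X (tE k L f) * iLi k L X a b - iLi k L X a b * iT k L X (tE k L (T (deg a) f))) ∨
    (∃ a b c d : X,
      w = (∑ x : X, ∑ y : X, iT k L X (sE k L (σ x y a c)) * iL k L X y d * iL k L X x b) -
        ∑ x : X, ∑ y : X, iT k L X (tE k L (σ b d x y)) * iL k L X c y * iL k L X a x) ∨
    w = 1 - iT k L X (1 : L ⊗[k] Lᵐᵒᵖ)}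

/-- The two-sided ideal `I_σ` of `k⟨Gen⟩`. -/
def Isig : TwoSidedIdeal (FreeAlgebra k (Gen k L X)) :=
  TwoSidedIdeal.span (relSet k L X G deg T σ)

/-- The quotient algebra `A_σ = k⟨Gen⟩ / I_σ`. -/
def Asig : Type _ := (Isig k L X G deg T σ).ringCon.Quotient

instance : Ring (Asig k L X G deg T σ) :=
  inferInstanceAs (Ring (RingCon.Quotient _))

/-- The quotient map `k⟨Gen⟩ → A_σ`, `w ↦ w + I_σ`. -/
def mkA : FreeAlgebra k (Gen k L X) →+* Asig k L X G deg T σ := RingCon.mk' _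

instance : Algebra k (Asig k L X G deg T σ) :=
  RingHom.toAlgebra' ((mkA k L X G deg T σ).comp (algebraMap k (FreeAlgebra k (Gen k L X))))
    (by
      intro c x
      obtain ⟨y, rfl⟩ := Quotient.mk''_surjective (α := FreeAlgebra k (Gen k L X)) x
      show mkA k L X G deg T σ _ * mkA k L X G deg T σ y =
        mkA k L X G deg T σ y * mkA k L X G deg T σ _
      rw [← map_mul, ← map_mul, Algebra.commutes])


/-- `σ` is rigid: there are families `x y : X → X → A_σ` satisfying the four
defining equations. -/
def IsRigid : Prop :=
  ∃ x y : X → X → Asig k L X G deg T σ, ∀ a b : X,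
    (∑ c : X, mkA k L X G deg T σ (iLi k L X c b) * x a c) = (if a = b then 1 else 0) ∧
    (∑ c : X, x c b * mkA k L X G deg T σ (iLi k L X a c)) = (if a = b then 1 else 0) ∧
    (∑ c : X, mkA k L X G deg T σ (iL k L X c b) * y a c) = (if a = b then 1 else 0) ∧
    (∑ c : X, y c b * mkA k L X G deg T σ (iL k L X a c)) = (if a = b then 1 else 0)

end

noncomputable section

/-- The `k`-algebra automorphism of `L = Q → R` given by composition with a permutation
`α` of `Q`: `T_α(f) = f ∘ α`. -/
def compAlgEquiv (k R Q : Type*) [CommRing k] [Ring R] [Algebra k R]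
    (α : Equiv.Perm Q) : (Q → R) ≃ₐ[k] (Q → R) where
  toFun f := fun x => f (α x)
  invFun f := fun x => f (α.symm x)
  left_inv f := by funext x; simp
  right_inv f := by funext x; simp
  map_mul' f g := rfl
  map_add' f g := rfl
  commutes' c := rfl

/-- `T : G → Aut_k(L)` for `G` the opposite group of the symmetric group of `Q`. -/
def Tq (k R Q : Type*) [CommRing k] [Ring R] [Algebra k R] :
    (Equiv.Perm Q)ᵐᵒᵖ → (Q → R) ≃ₐ[k] (Q → R) :=
  fun g => compAlgEquiv k R Q (MulOpposite.unop g)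

/-- Right translation `λ ↦ λa` of a quasigroup `Q` as a permutation of `Q`. -/
def rT (Q : Type*) [Mul Q] (hq1 : ∀ b c : Q, ∃! a : Q, a * b = c) (a : Q) :
    Equiv.Perm Q :=
  Equiv.ofBijective (fun l => l * a)
    ⟨fun x y h => (hq1 a (y * a)).unique h rfl,
     fun c => ⟨(hq1 a c).exists.choose, (hq1 a c).exists.choose_spec⟩⟩

/-- `deg : QG → G`, where `G` is the opposite group of the symmetric group of `H = QG`,
and `deg(a)` is the permutation `λ ↦ λa`. -/
def degq (Q : Type*) [Mul Q] (hq1 : ∀ b c : Q, ∃! a : Q, a * b = c) (a : Q) :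
    (Equiv.Perm Q)ᵐᵒᵖ :=
  MulOpposite.op (rT Q hq1 a)

/-- The element `σ^{ab}_{cd}` of `L = M_H(R)` constructed from the quasigroup `QG` and the
ternary operation `μ`. -/
def sigQG (R Q M : Type*) [Ring R] [Mul Q] [DecidableEq Q]
    (ldiv : Q → Q → Q) (π : Q ≃ M) (μ : M → M → M → M) (a b c d : Q) : Q → R :=
  fun l =>
    if c = ldiv (π.symm (μ (π l) (π (l * b)) (π (l * b * a)))) (l * b * a) ∧
       d = ldiv l (π.symm (μ (π l) (π (l * b)) (π (l * b * a)))) then 1 else 0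

/-- An algebra of faces for a ternary operation `m`: vertices `E`, faces `L` and
inverse faces `P`, such that products of two faces satisfy the exchange relation of `m`. -/
structure IsFaceAlgebra {A Q : Type*} [Ring A] [Fintype Q] [DecidableEq Q]
    (m : Q → Q → Q → Q) (E : Q → Q → A) (L P : Q → Q → Q → Q → A) : Prop where
  E_mul_L : ∀ l l' p p', E l p * L l l' p p' = L l l' p p'
  L_mul_E : ∀ l l' p p', L l l' p p' * E l' p' = L l l' p p'
  L_mul_P : ∀ l l' l'' p, ∑ q, L l l' p q * P l' l'' q p = if l = l'' then E l p else 0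
  P_mul_L : ∀ l' p p' p'', ∑ l, P l' l p' p * L l l' p p'' = if p' = p'' then E l' p' else 0
  L_mul_L : ∀ l v w p q r, L l v p q * L v w q r =
    L l (m l v w) p (m p q r) * L (m l v w) w (m p q r) r

namespace IsFaceAlgebra

variable {A Q : Type*} [Ring A] [Fintype Q] [DecidableEq Q]
  {m : Q → Q → Q → Q} {E : Q → Q → A} {L P : Q → Q → Q → Q → A}

theorem P_mul_L_eq_L_mul_P (h : IsFaceAlgebra m E L P)
    (h3 : ∀ b c d, ∃! a, m a b c = d) (h4 : ∀ a c d, ∃! b, m a b c = d)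
    (h5 : ∀ a b d, ∃! c, m a b c = d) (l v w p q r : Q) :
    P (m l v w) l (m p q r) p * L l v p q =
      L (m l v w) w (m p q r) r * P w v r q := by
  set v₂ := m l v w with hv₂
  set q₂ := m p q r with hq₂
  choose n hn hn' using fun i => h4 i w v₂
  have hn_iff (i : Q) : n i = v ↔ i = l := by
    constructor
    · intro hi
      exact (h3 v w v₂).unique (by rw [← hi]; exact hn i) hv₂.symm
    · rintro rfl
      exact (hn' i v hv₂.symm).symm
  have hr_iff (s : Q) : q₂ = m p q s ↔ s = r :=
    ⟨fun hs => (h5 p q q₂).unique hs.symm hq₂.symm, fun hs => by rw [hs]⟩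
  have h1 : ∑ i, ∑ s, P v₂ i q₂ p * (L i (n i) p q * (L (n i) w q s * P w v s q)) =
      P v₂ l q₂ p * L l v p q := by
    have (i : Q) : ∑ s, P v₂ i q₂ p * (L i (n i) p q * (L (n i) w q s * P w v s q)) =
        if i = l then P v₂ l q₂ p * L l v p q else 0 := by
      rw [← Finset.mul_sum, ← Finset.mul_sum, h.L_mul_P]
      split_ifs with ha hb hb
      · rw [h.L_mul_E, ha, hb]
      · exact absurd ((hn_iff i).1 ha) hb
      · exact absurd ((hn_iff i).2 hb) ha
      · simp
    simp [this]
  have h2 : ∑ s, ∑ i, P v₂ i q₂ p * (L i (n i) p q * (L (n i) w q s * P w v s q)) =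
      L v₂ w q₂ r * P w v r q := by
    have (s : Q) : ∑ i, P v₂ i q₂ p * (L i (n i) p q * (L (n i) w q s * P w v s q)) =
        if s = r then L v₂ w q₂ r * P w v r q else 0 := by
      have (i : Q) : P v₂ i q₂ p * (L i (n i) p q * (L (n i) w q s * P w v s q)) =
          P v₂ i q₂ p * L i v₂ p (m p q s) * (L v₂ w (m p q s) s * P w v s q) := by
        rw [← mul_assoc (L i (n i) p q), h.L_mul_L, hn]
        simp only [mul_assoc]
      rw [Finset.sum_congr rfl fun i _ => this i, ← Finset.sum_mul, h.P_mul_L]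
      split_ifs with ha hb hb
      · rw [← ha, ← mul_assoc, h.E_mul_L, hb]
      · exact absurd ((hr_iff s).1 ha) hb
      · exact absurd ((hr_iff s).2 hb) ha
      · simp
    simp [this]
  rw [← h1, ← h2, Finset.sum_comm]

theorem sum_L_mul_P (h : IsFaceAlgebra m E L P)
    (h3 : ∀ b c d, ∃! a, m a b c = d) (h4 : ∀ a c d, ∃! b, m a b c = d)
    (h5 : ∀ a b d, ∃! c, m a b c = d) (v q q₂ r : Q) :
    ∑ w, L v w q₂ r * P w v r q = if q₂ = q then E v q₂ else 0 := by
  obtain ⟨p, rfl, -⟩ := h3 q r q₂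
  choose n hn _ using fun l => h5 l v v
  have hbij : Function.Bijective n := by
    rw [← Finite.injective_iff_bijective]
    intro i j hij
    exact (h3 v (n i) v).unique (hn i) (by rw [hij]; exact hn j)
  rw [← h.P_mul_L v p, ← hbij.sum_comp]
  refine Finset.sum_congr rfl fun l _ => ?_
  have := h.P_mul_L_eq_L_mul_P h3 h4 h5 l v (n l) p q r
  rw [hn] at this
  exact this.symm

theorem sum_P_mul_L (h : IsFaceAlgebra m E L P)
    (h3 : ∀ b c d, ∃! a, m a b c = d) (h4 : ∀ a c d, ∃! b, m a b c = d)
    (h5 : ∀ a b d, ∃! c, m a b c = d) (l v v₂ q : Q) :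
    ∑ p, P v₂ l q p * L l v p q = if v₂ = v then E v₂ q else 0 := by
  obtain ⟨w, rfl, -⟩ := h5 l v v₂
  choose n hn _ using fun p => h5 p q q
  have hbij : Function.Bijective n := by
    rw [← Finite.injective_iff_bijective]
    intro i j hij
    exact (h3 q (n i) q).unique (hn i) (by rw [hij]; exact hn j)
  rw [← h.L_mul_P _ w, ← hbij.sum_comp fun r => L (m l v w) w q r * P w v r q]
  refine Finset.sum_congr rfl fun p _ => ?_
  have := h.P_mul_L_eq_L_mul_P h3 h4 h5 l v w p q (n p)
  rwa [hn] at this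

end IsFaceAlgebra

/-- A matrix `L` over a ring graded by a quasigroup through a partition of unity `E`, with inverse
`P`, satisfying the exchange relation of `m`: the transposes of `L` and `P` are also mutually
inverse. -/
theorem transpose_inverse_of_exchange {A Q : Type*} [Ring A] [Fintype Q] [DecidableEq Q] [Mul Q]
    (hq1 : ∀ b c : Q, ∃! a : Q, a * b = c) (hq2 : ∀ a c : Q, ∃! b : Q, a * b = c)
    (ldiv : Q → Q → Q) (hldiv : ∀ x y : Q, x * ldiv x y = y)
    (m : Q → Q → Q → Q) (h3 : ∀ b c d, ∃! a, m a b c = d) (h4 : ∀ a c d, ∃! b, m a b c = d)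
    (h5 : ∀ a b d, ∃! c, m a b c = d)
    (E L P : Q → Q → A) (hE : ∑ l, ∑ p, E l p = 1) (hEE : ∀ l p, E l p * E l p = E l p)
    (hEL : ∀ l p a b, E l p * L a b = L a b * E (l * a) (p * b))
    (hEP : ∀ l p a b, E (l * b) (p * a) * P a b = P a b * E l p)
    (hLP : ∀ a b, ∑ c, L a c * P c b = if a = b then 1 else 0)
    (hPL : ∀ a b, ∑ c, P a c * L c b = if a = b then 1 else 0)
    (hLL : ∀ l v w p q r, E l p * L (ldiv l v) (ldiv p q) * L (ldiv v w) (ldiv q r) =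
      E l p * L (ldiv l (m l v w)) (ldiv p (m p q r)) *
        L (ldiv (m l v w) w) (ldiv (m p q r) r)) (a b : Q) :
    (∑ c, L c b * P a c = if a = b then 1 else 0) ∧
      (∑ c, P c b * L a c = if a = b then 1 else 0) := by
  have hld (x y : Q) : ldiv x (x * y) = y := (hq2 x (x * y)).unique (hldiv _ _) rfl
  have hlinj (x : Q) : Function.Injective (x * ·) := fun y z hyz => (hq2 x _).unique hyz rfl
  have hldbij (x : Q) : Function.Bijective (ldiv x) :=
    ⟨fun y z hyz => by rw [← hldiv x y, hyz, hldiv], fun y => ⟨x * y, hld x y⟩⟩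
  have hdbij (y : Q) : Function.Bijective (ldiv · y) := by
    refine Finite.injective_iff_bijective.1 fun x z hxz => ?_
    refine (hq1 (ldiv x y) y).unique (hldiv _ _) ?_
    exact (congrArg (z * ·) hxz).trans (hldiv z y)
  have hdeq (x z y : Q) : ldiv x y = ldiv z y ↔ x = z := (hdbij y).1.eq_iff
  have hdeq' (x y z : Q) : ldiv x y = ldiv x z ↔ y = z := (hldbij x).1.eq_iff
  have hEL' (l l' p p' : Q) : E l p * L (ldiv l l') (ldiv p p') =
      L (ldiv l l') (ldiv p p') * E l' p' := by rw [hEL, hldiv, hldiv]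
  have hEP' (l l' p p' : Q) : E l' p' * P (ldiv p p') (ldiv l l') =
      P (ldiv p p') (ldiv l l') * E l p := by
    rw [← hEP, hldiv, hldiv]
  have hLL' (l v p q : Q) (x : A) : E l p * L (ldiv l v) (ldiv p q) * (E v q * x) =
      E l p * (L (ldiv l v) (ldiv p q) * x) := by
    rw [← mul_assoc, hEL', mul_assoc (L _ _), hEE, ← hEL', mul_assoc]
  have hPP' (l v p q : Q) (x : A) : E v q * P (ldiv p q) (ldiv l v) * (E l p * x) =
      E v q * (P (ldiv p q) (ldiv l v) * x) := by
    rw [← mul_assoc, hEP', mul_assoc (P _ _), hEE, ← hEP', mul_assoc]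
  have h : IsFaceAlgebra m E (fun l l' p p' => E l p * L (ldiv l l') (ldiv p p'))
      (fun l' l p' p => E l' p' * P (ldiv p p') (ldiv l l')) := by
    refine ⟨?_, ?_, ?_, ?_, ?_⟩
    · intro l l' p p'
      rw [← mul_assoc, hEE]
    · intro l l' p p'
      rw [hEL', mul_assoc, hEE]
    · intro l l' l'' p
      simp only [hLL', ← Finset.mul_sum]
      rw [(hldbij p).sum_comp fun c => L (ldiv l l') c * P c (ldiv l'' l'), hLP]
      simp only [hdeq, mul_ite, mul_one, mul_zero]
    · intro l' p p' p''
      simp only [hPP', ← Finset.mul_sum]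
      rw [(hdbij l').sum_comp fun c => P (ldiv p p') c * L c (ldiv p p''), hPL]
      simp only [hdeq', mul_ite, mul_one, mul_zero]
    · intro l v w p q r
      simp only [hLL']
      simpa only [mul_assoc] using hLL l v w p q r
  have hext (x y : A) (hxy : ∀ l p, E l p * x = E l p * y) : x = y := by
    rw [← one_mul x, ← one_mul y, ← hE]
    simp only [Finset.sum_mul, hxy]
  constructor
  · refine hext _ _ fun l p => ?_
    obtain ⟨q, hq, -⟩ := hq1 a (p * b)
    have hiff : p = q ↔ a = b := by
      constructor
      · rintro rfl
        exact (hq2 p (p * b)).unique hq rfl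
      · rintro rfl
        exact (hq1 a (p * a)).unique rfl hq
    have key := h.sum_L_mul_P h3 h4 h5 l q p (p * b)
    simp only [hLL', ← Finset.mul_sum] at key
    rw [hld, ← hq, hld, (hldbij l).sum_comp fun c => L c b * P a c] at key
    rw [key]
    simp only [hiff, mul_ite, mul_one, mul_zero]
  · refine hext _ _ fun l p => ?_
    obtain ⟨q, hq, -⟩ := hq1 b l
    have hiff : l = q * a ↔ a = b := by
      rw [← hq]
      exact ⟨fun hab => (hlinj q hab).symm, fun hab => by rw [hab]⟩
    have key := h.sum_P_mul_L h3 h4 h5 q (q * a) l p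
    simp only [hPP', ← Finset.mul_sum, hld, hiff] at key
    rw [← hq, hld, (hdbij p).sum_comp fun c => P c b * L a c, hq] at key
    rw [key]
    simp only [mul_ite, mul_one, mul_zero]

section Quotient

variable {k L X G : Type*} [CommRing k] [Ring L] [Algebra k L] [Fintype X] [DecidableEq X]
  (deg : X → G) (T : G → L ≃ₐ[k] L) (σ : X → X → X → X → L)

theorem mkA_eq_zero {w : FreeAlgebra k (Gen k L X)} (hw : w ∈ relSet k L X G deg T σ) :
    mkA k L X G deg T σ w = 0 := by
  have h : w ∈ Isig k L X G deg T σ := TwoSidedIdeal.subset_span hw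
  rw [TwoSidedIdeal.mem_iff] at h
  rw [← map_zero (mkA k L X G deg T σ)]
  exact (RingCon.eq _).2 h

theorem mkA_eq_mkA {v w : FreeAlgebra k (Gen k L X)} (hw : v - w ∈ relSet k L X G deg T σ) :
    mkA k L X G deg T σ v = mkA k L X G deg T σ w :=
  sub_eq_zero.1 <| by rw [← map_sub, mkA_eq_zero deg T σ hw]

/-- The ring homomorphism `L ⊗[k] Lᵐᵒᵖ → A_σ`. -/
def tensorToAsig : L ⊗[k] Lᵐᵒᵖ →+* Asig k L X G deg T σ where
  toFun ξ := mkA k L X G deg T σ (iT k L X ξ)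
  map_one' := by
    rw [← map_one (mkA k L X G deg T σ)]
    exact (mkA_eq_mkA deg T σ (by simp [relSet])).symm
  map_mul' ξ ξ' := by
    rw [← map_mul]
    exact (mkA_eq_mkA deg T σ (Or.inr <| Or.inr <| Or.inl ⟨ξ, ξ', rfl⟩)).symm
  map_zero' := by
    have h := mkA_eq_mkA deg T σ (v := iT k L X 0 + iT k L X 0) (w := iT k L X (0 + 0))
      (Or.inl ⟨0, 0, rfl⟩)
    rw [add_zero, map_add] at h
    exact add_eq_left.1 h
  map_add' ξ ξ' := by
    rw [← map_add]
    exact (mkA_eq_mkA deg T σ (Or.inl ⟨ξ, ξ', rfl⟩)).symm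

theorem tensorToAsig_apply (ξ : L ⊗[k] Lᵐᵒᵖ) :
    tensorToAsig deg T σ ξ = mkA k L X G deg T σ (iT k L X ξ) := rfl

theorem sE_mul_iL (f : L) (a b : X) :
    tensorToAsig deg T σ (sE k L (T (deg a) f)) * mkA k L X G deg T σ (iL k L X a b) =
      mkA k L X G deg T σ (iL k L X a b) * tensorToAsig deg T σ (sE k L f) := by
  rw [tensorToAsig_apply, tensorToAsig_apply, ← map_mul, ← map_mul]
  exact mkA_eq_mkA deg T σ (.inr <| .inr <| .inr <| .inr <| .inr <| .inl ⟨f, a, b, rfl⟩)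

theorem tE_mul_iL (f : L) (a b : X) :
    tensorToAsig deg T σ (tE k L (T (deg b) f)) * mkA k L X G deg T σ (iL k L X a b) =
      mkA k L X G deg T σ (iL k L X a b) * tensorToAsig deg T σ (tE k L f) := by
  rw [tensorToAsig_apply, tensorToAsig_apply, ← map_mul, ← map_mul]
  exact mkA_eq_mkA deg T σ
    (.inr <| .inr <| .inr <| .inr <| .inr <| .inr <| .inl ⟨f, a, b, rfl⟩)

theorem sE_mul_iLi (f : L) (a b : X) :
    tensorToAsig deg T σ (sE k L f) * mkA k L X G deg T σ (iLi k L X a b) =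
      mkA k L X G deg T σ (iLi k L X a b) * tensorToAsig deg T σ (sE k L (T (deg b) f)) := by
  rw [tensorToAsig_apply, tensorToAsig_apply, ← map_mul, ← map_mul]
  exact mkA_eq_mkA deg T σ
    (.inr <| .inr <| .inr <| .inr <| .inr <| .inr <| .inr <| .inl ⟨f, a, b, rfl⟩)

theorem tE_mul_iLi (f : L) (a b : X) :
    tensorToAsig deg T σ (tE k L f) * mkA k L X G deg T σ (iLi k L X a b) =
      mkA k L X G deg T σ (iLi k L X a b) * tensorToAsig deg T σ (tE k L (T (deg a) f)) := by
  rw [tensorToAsig_apply, tensorToAsig_apply, ← map_mul, ← map_mul]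
  exact mkA_eq_mkA deg T σ
    (.inr <| .inr <| .inr <| .inr <| .inr <| .inr <| .inr <| .inr <| .inl ⟨f, a, b, rfl⟩)

theorem sum_iL_mul_iLi (a b : X) :
    ∑ c, mkA k L X G deg T σ (iL k L X a c) * mkA k L X G deg T σ (iLi k L X c b) =
      if a = b then 1 else 0 := by
  have h := mkA_eq_mkA deg T σ (v := ∑ c, iL k L X a c * iLi k L X c b)
    (w := if a = b then 1 else 0) (.inr <| .inr <| .inr <| .inl ⟨a, b, rfl⟩)
  simpa [apply_ite] using h

theorem sum_iLi_mul_iL (a b : X) :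
    ∑ c, mkA k L X G deg T σ (iLi k L X a c) * mkA k L X G deg T σ (iL k L X c b) =
      if a = b then 1 else 0 := by
  have h := mkA_eq_mkA deg T σ (v := ∑ c, iLi k L X a c * iL k L X c b)
    (w := if a = b then 1 else 0) (.inr <| .inr <| .inr <| .inr <| .inl ⟨a, b, rfl⟩)
  simpa [apply_ite] using h

theorem sum_sE_mul_iL_mul_iL (a b c d : X) :
    ∑ x, ∑ y, tensorToAsig deg T σ (sE k L (σ x y a c)) * mkA k L X G deg T σ (iL k L X y d) *
        mkA k L X G deg T σ (iL k L X x b) =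
      ∑ x, ∑ y, tensorToAsig deg T σ (tE k L (σ b d x y)) * mkA k L X G deg T σ (iL k L X c y) *
        mkA k L X G deg T σ (iL k L X a x) := by
  simp only [tensorToAsig_apply, ← map_mul, ← map_sum]
  exact mkA_eq_mkA deg T σ (.inr <| .inr <| .inr <| .inr <| .inr <| .inr <| .inr <| .inr <|
    .inr <| .inl ⟨a, b, c, d, rfl⟩)

end Quotient

section Functions

variable {k R Q : Type*} [CommRing k] [Ring R] [Algebra k R] [DecidableEq Q]

theorem single_mul_ite (l : Q) (C : Q → Prop) [DecidablePred C] :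
    (Pi.single l 1 * fun i => if C i then 1 else 0 : Q → R) =
      if C l then Pi.single l 1 else 0 := by
  ext i
  obtain rfl | hi := eq_or_ne i l
  · split_ifs with h <;> simp [h]
  · split_ifs <;> simp [hi]

theorem ite_mul_single (l : Q) (C : Q → Prop) [DecidablePred C] :
    ((fun i => if C i then 1 else 0) * Pi.single l 1 : Q → R) =
      if C l then Pi.single l 1 else 0 := by
  ext i
  obtain rfl | hi := eq_or_ne i l
  · split_ifs with h <;> simp [h]
  · split_ifs <;> simp [hi]

variable [Mul Q] (hq1 : ∀ b c : Q, ∃! a : Q, a * b = c)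

theorem Tq_degq_single (l a : Q) :
    Tq k R Q (degq Q hq1 a) (Pi.single (l * a) 1) = Pi.single l 1 := by
  ext i
  have h : i * a = l * a ↔ i = l := ⟨fun h => (hq1 a _).unique h rfl, fun h => by rw [h]⟩
  show (Pi.single (l * a) 1 : Q → R) (i * a) = _
  simp only [Pi.single_apply, h]

end Functions

/-- The `σ` constructed from a finite quasigroup and a ternary operation `μ` satisfying
(QG1)–(QG5) is rigid. -/
theorem sigQG_isRigid (k R Q M : Type*) [CommRing k] [Ring R] [Algebra k R]
    [Fintype Q] [DecidableEq Q] [Nontrivial Q] [Mul Q]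
    (hq1 : ∀ b c : Q, ∃! a : Q, a * b = c) (hq2 : ∀ a c : Q, ∃! b : Q, a * b = c)
    (ldiv : Q → Q → Q) (hldiv : ∀ x y : Q, x * ldiv x y = y)
    (π : Q ≃ M) (μ : M → M → M → M)
    (hQG1 : ∀ a b c d : M, μ a (μ a b c) (μ (μ a b c) c d) = μ a b (μ b c d))
    (hQG2 : ∀ a b c d : M, μ (μ a b c) c d = μ (μ a b (μ b c d)) (μ b c d) d)
    (hQG3 : ∀ b c d : M, ∃! a : M, μ a b c = d)
    (hQG4 : ∀ a c d : M, ∃! b : M, μ a b c = d)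
    (hQG5 : ∀ a b d : M, ∃! c : M, μ a b c = d) :
    IsRigid k (Q → R) Q ((Equiv.Perm Q)ᵐᵒᵖ) (degq Q hq1) (Tq k R Q)
      (sigQG R Q M ldiv π μ) := by
  set deg := degq Q hq1
  set T := Tq k R Q
  set σ := sigQG R Q M ldiv π μ with hσ
  set m : Q → Q → Q → Q := fun l u w => π.symm (μ (π l) (π u) (π w)) with hm
  set j := tensorToAsig deg T σ
  set P : Q → Q → Asig k (Q → R) Q ((Equiv.Perm Q)ᵐᵒᵖ) deg T σ :=
    fun a b => mkA k (Q → R) Q ((Equiv.Perm Q)ᵐᵒᵖ) deg T σ (iLi k (Q → R) Q a b)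
  set F : Q → Q → Asig k (Q → R) Q ((Equiv.Perm Q)ᵐᵒᵖ) deg T σ :=
    fun a b => mkA k (Q → R) Q ((Equiv.Perm Q)ᵐᵒᵖ) deg T σ (iL k (Q → R) Q a b)
  let δ : Q → Q → R := fun l => Pi.single l 1
  let E : Q → Q → Asig k (Q → R) Q ((Equiv.Perm Q)ᵐᵒᵖ) deg T σ :=
    fun l p => j (δ l ⊗ₜ[k] op (δ p))
  have hδ : ∑ l, δ l = 1 := Finset.univ_sum_single (1 : Q → R)
  have hδδ (l : Q) : δ l * δ l = δ l := by
    ext i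
    by_cases hi : i = l <;> simp [δ, hi]
  have hst (l p : Q) : E l p = j (sE k (Q → R) (δ l)) * j (tE k (Q → R) (δ p)) := by
    rw [← map_mul]
    simp [E, sE, tE]
  have hEs (l p : Q) (C : Q → Prop) [DecidablePred C] :
      E l p * j (sE k (Q → R) fun i => if C i then 1 else 0) = if C l then E l p else 0 := by
    rw [← map_mul, sE, Algebra.TensorProduct.tmul_mul_tmul, single_mul_ite, mul_one]
    split_ifs <;> simp [E, δ]
  have hEt (l p : Q) (C : Q → Prop) [DecidablePred C] :
      E l p * j (tE k (Q → R) fun i => if C i then 1 else 0) = if C p then E l p else 0 := by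
    rw [← map_mul, tE, Algebra.TensorProduct.tmul_mul_tmul, ← op_mul, ite_mul_single, mul_one]
    split_ifs <;> simp [E, δ]
  have h3 (b c d : Q) : ∃! a, m a b c = d := by
    obtain ⟨e, he, he'⟩ := hQG3 (π b) (π c) (π d)
    refine ⟨π.symm e, by simp [hm, he], fun y hy => ?_⟩
    rw [Equiv.eq_symm_apply]
    exact he' _ (by rw [← hy]; simp [hm])
  have h4 (a c d : Q) : ∃! b, m a b c = d := by
    obtain ⟨e, he, he'⟩ := hQG4 (π a) (π c) (π d)
    refine ⟨π.symm e, by simp [hm, he], fun y hy => ?_⟩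
    rw [Equiv.eq_symm_apply]
    exact he' _ (by rw [← hy]; simp [hm])
  have h5 (a b d : Q) : ∃! c, m a b c = d := by
    obtain ⟨e, he, he'⟩ := hQG5 (π a) (π b) (π d)
    refine ⟨π.symm e, by simp [hm, he], fun y hy => ?_⟩
    rw [Equiv.eq_symm_apply]
    exact he' _ (by rw [← hy]; simp [hm])
  have main := transpose_inverse_of_exchange hq1 hq2 ldiv hldiv m h3 h4 h5 E F P ?_ ?_ ?_ ?_
    (sum_iL_mul_iLi deg T σ) (sum_iLi_mul_iL deg T σ) ?_
  · exact ⟨F, P, fun a b => ⟨(main a b).2, (main a b).1, (main a b).1, (main a b).2⟩⟩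
  · simp only [E, ← map_sum, ← TensorProduct.tmul_sum, ← TensorProduct.sum_tmul,
      ← Finset.op_sum, hδ]
    exact map_one j
  · intro l p
    simp only [E]
    rw [← map_mul, Algebra.TensorProduct.tmul_mul_tmul, ← op_mul, hδδ, hδδ]
  · intro l p a b
    have hs := sE_mul_iL deg T σ (δ (l * a)) a b
    have ht := tE_mul_iL deg T σ (δ (p * b)) a b
    rw [Tq_degq_single] at hs ht
    rw [hst, hst, mul_assoc, ht, ← mul_assoc, hs, mul_assoc]
  · intro l p a b
    have hs := sE_mul_iLi deg T σ (δ (l * b)) a b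
    have ht := tE_mul_iLi deg T σ (δ (p * a)) a b
    rw [Tq_degq_single] at hs ht
    rw [hst, hst, mul_assoc, ht, ← mul_assoc, hs, mul_assoc]
  · intro l v w p q r
    have key := congrArg (E l p * ·) (sum_sE_mul_iL_mul_iL deg T σ (ldiv (m l v w) w)
      (ldiv q r) (ldiv l (m l v w)) (ldiv p q))
    have hs (x y c d : Q) : E l p * j (sE k (Q → R) (σ x y c d)) =
        if c = ldiv (m l (l * y) (l * y * x)) (l * y * x) ∧ d = ldiv l (m l (l * y) (l * y * x))
        then E l p else 0 :=
      hEs l p fun i => c = ldiv (m i (i * y) (i * y * x)) (i * y * x) ∧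
        d = ldiv i (m i (i * y) (i * y * x))
    have ht (x y c d : Q) : E l p * j (tE k (Q → R) (σ x y c d)) =
        if c = ldiv (m p (p * y) (p * y * x)) (p * y * x) ∧ d = ldiv p (m p (p * y) (p * y * x))
        then E l p else 0 :=
      hEt l p fun i => c = ldiv (m i (i * y) (i * y * x)) (i * y * x) ∧
        d = ldiv i (m i (i * y) (i * y * x))
    have hC (x y : Q) : (ldiv (m l v w) w = ldiv (m l (l * y) (l * y * x)) (l * y * x) ∧
        ldiv l (m l v w) = ldiv l (m l (l * y) (l * y * x))) ↔
        x = ldiv v w ∧ y = ldiv l v := by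
      constructor
      · rintro ⟨h₁, h₂⟩
        have hm₂ : m l v w = m l (l * y) (l * y * x) := by
          rw [← hldiv l (m l v w), h₂, hldiv]
        have hw : w = l * y * x := by
          rw [← hldiv (m l v w) w, h₁, hm₂, hldiv]
        have hv : v = l * y := (h4 l w _).unique rfl (by rw [hm₂, ← hw])
        subst hv
        exact ⟨(hq2 (l * y) w).unique hw.symm (hldiv _ _), (hq2 l _).unique rfl (hldiv _ _)⟩
      · rintro ⟨rfl, rfl⟩
        simp only [hldiv, and_self]
    simp only [Finset.mul_sum, ← mul_assoc] at key
    change ∑ x, ∑ y, E l p * j _ * F _ _ * F _ _ = ∑ x, ∑ y, E l p * j _ * F _ _ * F _ _ at key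
    simp only [hs, ht, hC, hldiv, ite_and, ite_mul, zero_mul, Finset.sum_ite_eq',
      Finset.sum_ite_irrel, Finset.sum_const_zero, Finset.mem_univ, if_true] at key
    exact key

end
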